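/- Let f : ℝ² → ℝ² be a smooth vector field that is ℤ²-periodic (f(x + k) = f(x) for all k ∈ ℤ²), and let a₀, a₁ > 0. Consider the functional F(u) = ∫_{[0,1]²} [ f(x)·u(x) + a₀|u(x)|² + a₁(div u(x))² + a₁(curl u(x))² ] dx defined on smooth ℤ²-periodic vector fields u : ℝ² → ℝ², where div u = ∂u₁/∂x₁ + ∂u₂/∂x₂ and curl u = ∂u₂/∂x₁ − ∂u₁/∂x₂. Then F attains its minimum over smooth ℤ²-periodic vector fields at a unique minimizer u*, and u* is the unique smooth ℤ²-periodic solution of the elliptic equation a₀ u − a₁ Δu = −f/2, where Δ acts componentwise as the Laplacian ∂²/∂x₁² + ∂²/∂x₂². -/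

import Mathlib

open MeasureTheory

/-- Partial derivative in the first coordinate direction of a scalar field on `ℝ²`. -/
noncomputable def pd1 (f : ℝ × ℝ → ℝ) (x : ℝ × ℝ) : ℝ := fderiv ℝ f x (1, 0)

/-- Partial derivative in the second coordinate direction of a scalar field on `ℝ²`. -/
noncomputable def pd2 (f : ℝ × ℝ → ℝ) (x : ℝ × ℝ) : ℝ := fderiv ℝ f x (0, 1)

/-- Laplacian `∂²/∂x₁² + ∂²/∂x₂²` of a scalar field on `ℝ²`. -/
noncomputable def lap (f : ℝ × ℝ → ℝ) (x : ℝ × ℝ) : ℝ :=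
  pd1 (pd1 f) x + pd2 (pd2 f) x

/-- Divergence of a vector field on `ℝ²`. -/
noncomputable def divg (u : ℝ × ℝ → ℝ × ℝ) (x : ℝ × ℝ) : ℝ :=
  pd1 (fun y => (u y).1) x + pd2 (fun y => (u y).2) x

/-- Scalar vorticity (curl) of a vector field on `ℝ²`. -/
noncomputable def curl (u : ℝ × ℝ → ℝ × ℝ) (x : ℝ × ℝ) : ℝ :=
  pd1 (fun y => (u y).2) x - pd2 (fun y => (u y).1) x

/-- `ℤ²`-periodicity of a map on `ℝ²`. -/
def ZZPeriodic {α : Type*} (f : ℝ × ℝ → α) : Prop :=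
  ∀ (x : ℝ × ℝ) (k : ℤ × ℤ), f (x + ((k.1 : ℝ), (k.2 : ℝ))) = f x

/-- The unit square `[0,1]²` in `ℝ²`. -/
def unitSquare : Set (ℝ × ℝ) := Set.Icc ((0 : ℝ), (0 : ℝ)) (1, 1)

/-- The functional
`F(u) = ∫_{[0,1]²} f·u + a₀|u|² + a₁(div u)² + a₁(curl u)² dx`. -/
noncomputable def Ffunc (f : ℝ × ℝ → ℝ × ℝ) (a₀ a₁ : ℝ) (u : ℝ × ℝ → ℝ × ℝ) : ℝ :=
  ∫ x in unitSquare,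
    ((f x).1 * (u x).1 + (f x).2 * (u x).2
      + a₀ * ((u x).1 ^ 2 + (u x).2 ^ 2)
      + a₁ * (divg u x) ^ 2 + a₁ * (curl u x) ^ 2)


lemma pd1_smooth {g : ℝ × ℝ → ℝ} (hg : ContDiff ℝ (⊤ : ℕ∞) g) : ContDiff ℝ (⊤ : ℕ∞) (pd1 g) :=
  (hg.fderiv_right (m := (⊤ : ℕ∞)) (by norm_cast)).clm_apply contDiff_const

lemma pd2_smooth {g : ℝ × ℝ → ℝ} (hg : ContDiff ℝ (⊤ : ℕ∞) g) : ContDiff ℝ (⊤ : ℕ∞) (pd2 g) :=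
  (hg.fderiv_right (m := (⊤ : ℕ∞)) (by norm_cast)).clm_apply contDiff_const

lemma fderiv_periodic {E : Type} [NormedAddCommGroup E] [NormedSpace ℝ E] {g : ℝ × ℝ → E}
    (hp : ZZPeriodic g) : ZZPeriodic (fderiv ℝ g) := by
  intro x k
  rw [← fderiv_comp_add_right]
  congr 1
  funext y
  exact hp y k

lemma pd1_periodic {g : ℝ × ℝ → ℝ} (hp : ZZPeriodic g) : ZZPeriodic (pd1 g) := by
  intro x k
  simp only [pd1, fderiv_periodic hp x k]

lemma pd2_periodic {g : ℝ × ℝ → ℝ} (hp : ZZPeriodic g) : ZZPeriodic (pd2 g) := by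
  intro x k
  simp only [pd2, fderiv_periodic hp x k]

lemma pd_comm {g : ℝ × ℝ → ℝ} (hg : ContDiff ℝ (⊤ : ℕ∞) g) (x : ℝ × ℝ) :
    pd1 (pd2 g) x = pd2 (pd1 g) x := by
  have hs : IsSymmSndFDerivAt ℝ g x :=
    hg.contDiffAt.isSymmSndFDerivAt (by simp; norm_cast)
  have hd : DifferentiableAt ℝ (fderiv ℝ g) x :=
    (hg.fderiv_right (m := (⊤ : ℕ∞)) (by norm_cast)).differentiable (by simp) x
  have h1 : ∀ v w, fderiv ℝ (fun y => fderiv ℝ g y v) x w = fderiv ℝ (fderiv ℝ g) x w v := by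
    intro v w
    rw [fderiv_clm_apply hd (differentiableAt_const _)]
    simp
  change fderiv ℝ (fun y => fderiv ℝ g y (0,1)) x (1,0) = fderiv ℝ (fun y => fderiv ℝ g y (1,0)) x (0,1)
  rw [h1, h1]
  exact hs _ _

lemma pd1_add {g h : ℝ × ℝ → ℝ} (hg : ContDiff ℝ (⊤ : ℕ∞) g) (hh : ContDiff ℝ (⊤ : ℕ∞) h)
    (x : ℝ × ℝ) : pd1 (fun y => g y + h y) x = pd1 g x + pd1 h x := by
  simp only [pd1]
  rw [fderiv_fun_add (hg.differentiable (by simp) x) (hh.differentiable (by simp) x)]; rfl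

lemma pd2_add {g h : ℝ × ℝ → ℝ} (hg : ContDiff ℝ (⊤ : ℕ∞) g) (hh : ContDiff ℝ (⊤ : ℕ∞) h)
    (x : ℝ × ℝ) : pd2 (fun y => g y + h y) x = pd2 g x + pd2 h x := by
  simp only [pd2]
  rw [fderiv_fun_add (hg.differentiable (by simp) x) (hh.differentiable (by simp) x)]; rfl

lemma pd1_sub {g h : ℝ × ℝ → ℝ} (hg : ContDiff ℝ (⊤ : ℕ∞) g) (hh : ContDiff ℝ (⊤ : ℕ∞) h)
    (x : ℝ × ℝ) : pd1 (fun y => g y - h y) x = pd1 g x - pd1 h x := by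
  simp only [pd1]
  rw [fderiv_fun_sub (hg.differentiable (by simp) x) (hh.differentiable (by simp) x)]; rfl

lemma pd2_sub {g h : ℝ × ℝ → ℝ} (hg : ContDiff ℝ (⊤ : ℕ∞) g) (hh : ContDiff ℝ (⊤ : ℕ∞) h)
    (x : ℝ × ℝ) : pd2 (fun y => g y - h y) x = pd2 g x - pd2 h x := by
  simp only [pd2]
  rw [fderiv_fun_sub (hg.differentiable (by simp) x) (hh.differentiable (by simp) x)]; rfl

lemma pd1_mul {g h : ℝ × ℝ → ℝ} (hg : ContDiff ℝ (⊤ : ℕ∞) g) (hh : ContDiff ℝ (⊤ : ℕ∞) h)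
    (x : ℝ × ℝ) : pd1 (fun y => g y * h y) x = g x * pd1 h x + h x * pd1 g x := by
  simp only [pd1]
  rw [fderiv_fun_mul (hg.differentiable (by simp) x) (hh.differentiable (by simp) x)]; rfl

lemma pd2_mul {g h : ℝ × ℝ → ℝ} (hg : ContDiff ℝ (⊤ : ℕ∞) g) (hh : ContDiff ℝ (⊤ : ℕ∞) h)
    (x : ℝ × ℝ) : pd2 (fun y => g y * h y) x = g x * pd2 h x + h x * pd2 g x := by
  simp only [pd2]
  rw [fderiv_fun_mul (hg.differentiable (by simp) x) (hh.differentiable (by simp) x)]; rfl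

lemma intOn {g : ℝ × ℝ → ℝ} (hg : Continuous g) : IntegrableOn g unitSquare :=
  hg.continuousOn.integrableOn_compact isCompact_Icc

lemma integral_div_zero {P Q : ℝ × ℝ → ℝ} (hP : ContDiff ℝ (⊤ : ℕ∞) P)
    (hQ : ContDiff ℝ (⊤ : ℕ∞) Q) (pP : ZZPeriodic P) (pQ : ZZPeriodic Q) :
    ∫ x in unitSquare, (pd1 P x + pd2 Q x) = 0 := by
  have h := integral_divergence_prod_Icc_of_hasFDerivAt_of_le P Q (fderiv ℝ P) (fderiv ℝ Q)
    ((0 : ℝ), (0 : ℝ)) (1, 1) (by constructor <;> simp) hP.continuous.continuousOn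
    hQ.continuous.continuousOn
    (fun x _ => (hP.differentiable (by simp) x).hasFDerivAt)
    (fun x _ => (hQ.differentiable (by simp) x).hasFDerivAt)
    (intOn ((pd1_smooth hP).continuous.add (pd2_smooth hQ).continuous))
  have h1 : ∀ y : ℝ, Q (y, 1) = Q (y, 0) := fun y => by simpa using pQ (y, 0) (0, 1)
  have h2 : ∀ y : ℝ, P (1, y) = P (0, y) := fun y => by simpa using pP (0, y) (1, 0)
  simp only [h1, h2] at h
  unfold unitSquare pd1 pd2
  rw [h]; ring

/-- The quadratic part of the functional. -/
noncomputable def quadPart (a₀ a₁ : ℝ) (v : ℝ × ℝ → ℝ × ℝ) (x : ℝ × ℝ) : ℝ :=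
  a₀ * ((v x).1 ^ 2 + (v x).2 ^ 2) + a₁ * (divg v x) ^ 2 + a₁ * (curl v x) ^ 2

def SolvesPDE (f : ℝ × ℝ → ℝ × ℝ) (a₀ a₁ : ℝ) (u : ℝ × ℝ → ℝ × ℝ) : Prop :=
  ∀ x : ℝ × ℝ,
    a₀ * (u x).1 - a₁ * lap (fun y => (u y).1) x = -(f x).1 / 2 ∧
    a₀ * (u x).2 - a₁ * lap (fun y => (u y).2) x = -(f x).2 / 2

lemma divg_smooth {u : ℝ × ℝ → ℝ × ℝ} (hu : ContDiff ℝ (⊤ : ℕ∞) u) :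
    ContDiff ℝ (⊤ : ℕ∞) (divg u) := (pd1_smooth hu.fst).add (pd2_smooth hu.snd)

lemma curl_smooth {u : ℝ × ℝ → ℝ × ℝ} (hu : ContDiff ℝ (⊤ : ℕ∞) u) :
    ContDiff ℝ (⊤ : ℕ∞) (curl u) := (pd1_smooth hu.snd).sub (pd2_smooth hu.fst)

lemma fst_periodic {u : ℝ × ℝ → ℝ × ℝ} (hu : ZZPeriodic u) : ZZPeriodic (fun y => (u y).1) :=
  fun x k => congrArg Prod.fst (hu x k)

lemma snd_periodic {u : ℝ × ℝ → ℝ × ℝ} (hu : ZZPeriodic u) : ZZPeriodic (fun y => (u y).2) :=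
  fun x k => congrArg Prod.snd (hu x k)

lemma divg_periodic {u : ℝ × ℝ → ℝ × ℝ} (hu : ZZPeriodic u) : ZZPeriodic (divg u) := by
  intro x k
  simp only [divg, pd1_periodic (fst_periodic hu) x k, pd2_periodic (snd_periodic hu) x k]

lemma curl_periodic {u : ℝ × ℝ → ℝ × ℝ} (hu : ZZPeriodic u) : ZZPeriodic (curl u) := by
  intro x k
  simp only [curl, pd1_periodic (snd_periodic hu) x k, pd2_periodic (fst_periodic hu) x k]

lemma quad_cont {v : ℝ × ℝ → ℝ × ℝ} (a₀ a₁ : ℝ) (hv : ContDiff ℝ (⊤ : ℕ∞) v) :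
    Continuous (quadPart a₀ a₁ v) := by
  have h1 := (divg_smooth hv).continuous
  have h2 := (curl_smooth hv).continuous
  have h3 := hv.continuous
  unfold quadPart
  fun_prop

lemma energy {f : ℝ × ℝ → ℝ × ℝ} {a₀ a₁ : ℝ} {u v : ℝ × ℝ → ℝ × ℝ}
    (hf : ContDiff ℝ (⊤ : ℕ∞) f)
    (hu : ContDiff ℝ (⊤ : ℕ∞) u) (pu : ZZPeriodic u)
    (hv : ContDiff ℝ (⊤ : ℕ∞) v) (pv : ZZPeriodic v) (hs : SolvesPDE f a₀ a₁ u) :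
    Ffunc f a₀ a₁ (fun x => u x + v x) =
      Ffunc f a₀ a₁ u + ∫ x in unitSquare, quadPart a₀ a₁ v x := by
  have hD := divg_smooth hu
  have hC := curl_smooth hu
  have hP : ContDiff ℝ (⊤ : ℕ∞) (fun x => divg u x * (v x).1 + curl u x * (v x).2) :=
    (hD.mul hv.fst).add (hC.mul hv.snd)
  have hQ : ContDiff ℝ (⊤ : ℕ∞) (fun x => divg u x * (v x).2 - curl u x * (v x).1) :=
    (hD.mul hv.snd).sub (hC.mul hv.fst)
  have h0 := integral_div_zero hP hQ
    (fun x k => by simp only [divg_periodic pu x k, curl_periodic pu x k, pv x k])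
    (fun x k => by simp only [divg_periodic pu x k, curl_periodic pu x k, pv x k])
  set P := (fun x => divg u x * (v x).1 + curl u x * (v x).2) with hPdef
  set Q := (fun x => divg u x * (v x).2 - curl u x * (v x).1) with hQdef
  have hI0 : IntegrableOn (fun x => (f x).1 * (u x).1 + (f x).2 * (u x).2
      + a₀ * ((u x).1 ^ 2 + (u x).2 ^ 2)
      + a₁ * (divg u x) ^ 2 + a₁ * (curl u x) ^ 2) unitSquare := by
    apply intOn
    have h1 := hD.continuous
    have h2 := hC.continuous
    have h3 := hf.continuous
    have h4 := hu.continuous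
    fun_prop
  have hI1 : IntegrableOn (quadPart a₀ a₁ v) unitSquare := intOn (quad_cont a₀ a₁ hv)
  have hI2 : IntegrableOn (fun x => pd1 P x + pd2 Q x) unitSquare :=
    intOn ((pd1_smooth hP).continuous.add (pd2_smooth hQ).continuous)
  have key : ∀ x, (f x).1 * (u x + v x).1 + (f x).2 * (u x + v x).2
      + a₀ * ((u x + v x).1 ^ 2 + (u x + v x).2 ^ 2)
      + a₁ * (divg (fun x => u x + v x) x) ^ 2 + a₁ * (curl (fun x => u x + v x) x) ^ 2
      = (((f x).1 * (u x).1 + (f x).2 * (u x).2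
      + a₀ * ((u x).1 ^ 2 + (u x).2 ^ 2)
      + a₁ * (divg u x) ^ 2 + a₁ * (curl u x) ^ 2) + quadPart a₀ a₁ v x)
      + 2 * a₁ * (pd1 P x + pd2 Q x) := by
    intro x
    obtain ⟨e1, e2⟩ := hs x
    have d1 : pd1 P x = divg u x * pd1 (fun y => (v y).1) x + (v x).1 * pd1 (divg u) x
        + (curl u x * pd1 (fun y => (v y).2) x + (v x).2 * pd1 (curl u) x) := by
      rw [hPdef, pd1_add (hD.mul hv.fst) (hC.mul hv.snd), pd1_mul hD hv.fst, pd1_mul hC hv.snd]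
    have d2 : pd2 Q x = divg u x * pd2 (fun y => (v y).2) x + (v x).2 * pd2 (divg u) x
        - (curl u x * pd2 (fun y => (v y).1) x + (v x).1 * pd2 (curl u) x) := by
      rw [hQdef, pd2_sub (hD.mul hv.snd) (hC.mul hv.fst), pd2_mul hD hv.snd, pd2_mul hC hv.fst]
    have d3 : pd1 (divg u) x = pd1 (pd1 (fun y => (u y).1)) x + pd1 (pd2 (fun y => (u y).2)) x :=
      pd1_add (pd1_smooth hu.fst) (pd2_smooth hu.snd) x
    have d4 : pd2 (divg u) x = pd2 (pd1 (fun y => (u y).1)) x + pd2 (pd2 (fun y => (u y).2)) x :=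
      pd2_add (pd1_smooth hu.fst) (pd2_smooth hu.snd) x
    have d5 : pd1 (curl u) x = pd1 (pd1 (fun y => (u y).2)) x - pd1 (pd2 (fun y => (u y).1)) x :=
      pd1_sub (pd1_smooth hu.snd) (pd2_smooth hu.fst) x
    have d6 : pd2 (curl u) x = pd2 (pd1 (fun y => (u y).2)) x - pd2 (pd2 (fun y => (u y).1)) x :=
      pd2_sub (pd1_smooth hu.snd) (pd2_smooth hu.fst) x
    have d7 : divg (fun x => u x + v x) x = divg u x + divg v x := by
      simp only [divg, Prod.fst_add, Prod.snd_add]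
      rw [pd1_add hu.fst hv.fst, pd2_add hu.snd hv.snd]; ring
    have d8 : curl (fun x => u x + v x) x = curl u x + curl v x := by
      simp only [curl, Prod.fst_add, Prod.snd_add]
      rw [pd1_add hu.snd hv.snd, pd2_add hu.fst hv.fst]; ring
    have d9 : divg v x = pd1 (fun y => (v y).1) x + pd2 (fun y => (v y).2) x := rfl
    have d10 : curl v x = pd1 (fun y => (v y).2) x - pd2 (fun y => (v y).1) x := rfl
    have c1 := pd_comm hu.fst x
    have c2 := pd_comm hu.snd x
    rw [d7, d8, d1, d2, d3, d4, d5, d6, c1, c2, quadPart, d9, d10]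
    simp only [lap] at e1 e2
    simp only [Prod.fst_add, Prod.snd_add]
    linear_combination (2 * (v x).1) * e1 + (2 * (v x).2) * e2
  unfold Ffunc
  simp only [key]
  have hI3 := hI0.add hI1
  have hI4 := hI2.const_mul (2 * a₁)
  erw [integral_add hI3 hI4]
  erw [integral_add hI0 hI1]
  rw [integral_const_mul, h0]
  ring

lemma zero_of_quad {a₀ a₁ : ℝ} (ha₀ : 0 < a₀) (ha₁ : 0 < a₁) {v : ℝ × ℝ → ℝ × ℝ}
    (hv : ContDiff ℝ (⊤ : ℕ∞) v) (pv : ZZPeriodic v)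
    (h : ∫ x in unitSquare, quadPart a₀ a₁ v x ≤ 0) : ∀ x, v x = 0 := by
  have hn : ∀ x, 0 ≤ quadPart a₀ a₁ v x := fun x => by unfold quadPart; positivity
  have h0 : ∫ x in unitSquare, quadPart a₀ a₁ v x = 0 := le_antisymm h (integral_nonneg hn)
  have hq := quad_cont a₀ a₁ hv
  rw [integral_eq_zero_iff_of_nonneg hn (intOn hq)] at h0
  have h1 : Set.EqOn (quadPart a₀ a₁ v) 0 unitSquare := by
    refine Measure.eqOn_of_ae_eq h0 hq.continuousOn continuousOn_const ?_
    unfold unitSquare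
    rw [← Set.Icc_prod_Icc, interior_prod_eq, closure_prod_eq, interior_Icc, closure_Ioo (by simp)]
  have h2 : ∀ x ∈ unitSquare, v x = 0 := by
    intro x hx
    have := h1 hx
    simp only [quadPart, Pi.zero_apply] at this
    have e1 : 0 ≤ a₁ * (divg v x) ^ 2 := by positivity
    have e2 : 0 ≤ a₁ * (curl v x) ^ 2 := by positivity
    have e3 : a₀ * ((v x).1 ^ 2 + (v x).2 ^ 2) ≤ 0 := by linarith
    have e4 : (v x).1 ^ 2 + (v x).2 ^ 2 ≤ 0 := by
      by_contra hc
      push Not at hc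
      nlinarith [mul_pos ha₀ hc]
    ext
    · simp only [Prod.fst_zero]; nlinarith [sq_nonneg (v x).1, sq_nonneg (v x).2]
    · simp only [Prod.snd_zero]; nlinarith [sq_nonneg (v x).1, sq_nonneg (v x).2]
  intro x
  have := pv x (-⌊x.1⌋, -⌊x.2⌋)
  rw [← this]
  apply h2
  simp only [unitSquare, Set.mem_Icc, Prod.le_def]
  have a1 := Int.floor_le x.1
  have a2 := Int.floor_le x.2
  have a3 := (Int.lt_floor_add_one x.1).le
  have a4 := (Int.lt_floor_add_one x.2).le
  refine ⟨⟨?_, ?_⟩, ⟨?_, ?_⟩⟩ <;> push_cast <;> simp only [Prod.fst_add, Prod.snd_add] <;> linarith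

lemma bounded_of_periodic {E : Type} [NormedAddCommGroup E] {g : ℝ × ℝ → E}
    (hg : Continuous g) (hp : ZZPeriodic g) : ∃ M : ℝ, ∀ x, ‖g x‖ ≤ M := by
  obtain ⟨M, hM⟩ := (isCompact_Icc (a := ((0 : ℝ), (0 : ℝ))) (b := (1, 1))).exists_bound_of_continuousOn
    hg.continuousOn
  refine ⟨M, fun x => ?_⟩
  rw [← hp x (-⌊x.1⌋, -⌊x.2⌋)]
  apply hM
  simp only [Set.mem_Icc, Prod.le_def]
  have a1 := Int.floor_le x.1
  have a2 := Int.floor_le x.2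
  have a3 := (Int.lt_floor_add_one x.1).le
  have a4 := (Int.lt_floor_add_one x.2).le
  refine ⟨⟨?_, ?_⟩, ⟨?_, ?_⟩⟩ <;> push_cast <;> simp only [Prod.fst_add, Prod.snd_add] <;> linarith

lemma integrable_of_periodic {E : Type} [NormedAddCommGroup E] {g : ℝ × ℝ → E}
    (hg : Continuous g) (hp : ZZPeriodic g) {Ω : Type} [TopologicalSpace Ω] [MeasurableSpace Ω]
    [OpensMeasurableSpace Ω] [SecondCountableTopology Ω] (μ : Measure Ω) [IsFiniteMeasure μ]
    {Y : Ω → ℝ × ℝ} (hY : Continuous Y) :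
    Integrable (fun y => g (Y y)) μ := by
  obtain ⟨M, hM⟩ := bounded_of_periodic hg hp
  have h0 : AEStronglyMeasurable (fun y => g (Y y)) μ := by
    have : StronglyMeasurable g := hg.stronglyMeasurable
    exact (this.comp_measurable hY.measurable).aestronglyMeasurable
  exact Integrable.of_bound h0 M (Filter.Eventually.of_forall fun y => hM _)

lemma hasFDerivAt_avg {E : Type} [NormedAddCommGroup E] [NormedSpace ℝ E] {g : ℝ × ℝ → E}
    (hg : ContDiff ℝ (⊤ : ℕ∞) g) (hp : ZZPeriodic g) (μ : Measure (ℝ × ℝ)) [IsFiniteMeasure μ]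
    (x : ℝ × ℝ) :
    HasFDerivAt (fun x => ∫ y, g (x + y) ∂μ) (∫ y, fderiv ℝ g (x + y) ∂μ) x := by
  have hg' : ContDiff ℝ (⊤ : ℕ∞) (fderiv ℝ g) := hg.fderiv_right (m := (⊤ : ℕ∞)) (by norm_cast)
  obtain ⟨M, hM⟩ := bounded_of_periodic hg'.continuous (fderiv_periodic hp)
  have hc : ∀ x : ℝ × ℝ, Continuous fun y : ℝ × ℝ => x + y := fun x => by fun_prop
  refine hasFDerivAt_integral_of_dominated_of_fderiv_le (s := Set.univ) (bound := fun _ => M)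
    (F' := fun x y => fderiv ℝ g (x + y)) Filter.univ_mem ?_ ?_ ?_ ?_ (integrable_const _) ?_
  · exact Filter.Eventually.of_forall fun x => (integrable_of_periodic hg.continuous hp μ (hc x)).1
  · exact integrable_of_periodic hg.continuous hp μ (hc x)
  · exact (integrable_of_periodic hg'.continuous (fderiv_periodic hp) μ (hc x)).1
  · exact Filter.Eventually.of_forall fun y x _ => hM _
  · refine Filter.Eventually.of_forall fun y x _ => ?_
    exact (hasFDerivAt_comp_add_right y).2 (hg.differentiable (by simp) (x + y)).hasFDerivAt

lemma contDiff_avg_nat (μ : Measure (ℝ × ℝ)) [IsFiniteMeasure μ] (n : ℕ) :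
    ∀ {E : Type} [NormedAddCommGroup E] [NormedSpace ℝ E] {g : ℝ × ℝ → E}
    (_ : ContDiff ℝ (⊤ : ℕ∞) g) (_ : ZZPeriodic g), ContDiff ℝ n (fun x => ∫ y, g (x + y) ∂μ) := by
  induction n with
  | zero =>
    intro E _ _ g hg hp
    simp only [Nat.cast_zero, contDiff_zero]
    exact continuous_iff_continuousAt.2 fun x => (hasFDerivAt_avg hg hp μ x).continuousAt
  | succ n ih =>
    intro E _ _ g hg hp
    push_cast
    rw [contDiff_succ_iff_fderiv]
    refine ⟨fun x => (hasFDerivAt_avg hg hp μ x).differentiableAt, by simp, ?_⟩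
    have : fderiv ℝ (fun x => ∫ y, g (x + y) ∂μ) = fun x => ∫ y, fderiv ℝ g (x + y) ∂μ :=
      funext fun x => (hasFDerivAt_avg hg hp μ x).fderiv
    rw [this]
    exact ih (hg.fderiv_right (m := (⊤ : ℕ∞)) (by norm_cast)) (fderiv_periodic hp)

lemma contDiff_avg (μ : Measure (ℝ × ℝ)) [IsFiniteMeasure μ] {g : ℝ × ℝ → ℝ}
    (hg : ContDiff ℝ (⊤ : ℕ∞) g) (hp : ZZPeriodic g) :
    ContDiff ℝ (⊤ : ℕ∞) (fun x => ∫ y, g (x + y) ∂μ) :=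
  contDiff_infty.2 fun n => contDiff_avg_nat μ n hg hp

lemma fderiv_avg (μ : Measure (ℝ × ℝ)) [IsFiniteMeasure μ] {g : ℝ × ℝ → ℝ}
    (hg : ContDiff ℝ (⊤ : ℕ∞) g) (hp : ZZPeriodic g) (x v : ℝ × ℝ) :
    fderiv ℝ (fun x => ∫ y, g (x + y) ∂μ) x v = ∫ y, fderiv ℝ g (x + y) v ∂μ := by
  rw [(hasFDerivAt_avg hg hp μ x).fderiv]
  have hg' : ContDiff ℝ (⊤ : ℕ∞) (fderiv ℝ g) := hg.fderiv_right (m := (⊤ : ℕ∞)) (by norm_cast)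
  exact ContinuousLinearMap.integral_apply
    (integrable_of_periodic hg'.continuous (fderiv_periodic hp) μ (by fun_prop)) v

lemma lap_avg (μ : Measure (ℝ × ℝ)) [IsFiniteMeasure μ] {g : ℝ × ℝ → ℝ}
    (hg : ContDiff ℝ (⊤ : ℕ∞) g) (hp : ZZPeriodic g) (x : ℝ × ℝ) :
    lap (fun x => ∫ y, g (x + y) ∂μ) x = ∫ y, lap g (x + y) ∂μ := by
  have h1 : pd1 (fun x => ∫ y, g (x + y) ∂μ) = fun x => ∫ y, pd1 g (x + y) ∂μ :=
    funext fun x => fderiv_avg μ hg hp x _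
  have h2 : pd2 (fun x => ∫ y, g (x + y) ∂μ) = fun x => ∫ y, pd2 g (x + y) ∂μ :=
    funext fun x => fderiv_avg μ hg hp x _
  have h3 : pd1 (fun x => ∫ y, pd1 g (x + y) ∂μ) x = ∫ y, pd1 (pd1 g) (x + y) ∂μ :=
    fderiv_avg μ (pd1_smooth hg) (pd1_periodic hp) x _
  have h4 : pd2 (fun x => ∫ y, pd2 g (x + y) ∂μ) x = ∫ y, pd2 (pd2 g) (x + y) ∂μ :=
    fderiv_avg μ (pd2_smooth hg) (pd2_periodic hp) x _
  unfold lap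
  rw [h1, h2, h3, h4, integral_add]
  · exact integrable_of_periodic (pd1_smooth (pd1_smooth hg)).continuous
      (pd1_periodic (pd1_periodic hp)) μ (by fun_prop)
  · exact integrable_of_periodic (pd2_smooth (pd2_smooth hg)).continuous
      (pd2_periodic (pd2_periodic hp)) μ (by fun_prop)

open ProbabilityTheory in
lemma stein {φ φ' : ℝ → ℝ} (hd : ∀ z, HasDerivAt φ (φ' z) z) (hc : Continuous φ') {M : ℝ}
    (hM : ∀ z, ‖φ z‖ ≤ M) (hM' : ∀ z, ‖φ' z‖ ≤ M) :
    ∫ z, z * φ z ∂(gaussianReal 0 1) = ∫ z, φ' z ∂(gaussianReal 0 1) := by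
  have hφ : Continuous φ := continuous_iff_continuousAt.2 fun z => (hd z).continuousAt
  rw [integral_gaussianReal_eq_integral_smul (by simp), integral_gaussianReal_eq_integral_smul (by simp)]
  set p := gaussianPDFReal 0 1 with hp
  have hpd : ∀ z, HasDerivAt p (- z * p z) z := by
    intro z
    have e : p = fun x => (√(2 * Real.pi))⁻¹ * Real.exp (-x ^ 2 / 2) := by
      rw [hp, gaussianPDFReal_def]; simp
    rw [e]
    have h1 : HasDerivAt (fun x : ℝ => -x ^ 2 / 2) (-z) z := by
      refine HasDerivAt.congr_deriv (((hasDerivAt_pow 2 z).neg).div_const 2) ?_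
      norm_num
      ring
    refine HasDerivAt.congr_deriv (h1.exp.const_mul ((√(2 * Real.pi))⁻¹)) ?_
    ring
  have hpi : Integrable p := integrable_gaussianPDFReal 0 1
  have hzp : Integrable (fun z => z * p z) := by
    have := (integrable_mul_exp_neg_mul_sq (b := 1/2) (by norm_num)).const_mul ((√(2 * Real.pi))⁻¹)
    refine this.congr (Filter.Eventually.of_forall fun z => ?_)
    simp only [hp, gaussianPDFReal_def]
    have : -(1/2) * z ^ 2 = -(z - 0) ^ 2 / (2 * ((1 : NNReal) : ℝ)) := by simp; ring
    rw [this]; simp; ring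
  have hI1 : Integrable (fun z => φ z * (- z * p z)) := by
    have := hzp.neg.bdd_mul (c := M) hφ.aestronglyMeasurable (Filter.Eventually.of_forall hM)
    refine this.congr (Filter.Eventually.of_forall fun z => ?_)
    simp
  have hI2 : Integrable (fun z => φ' z * p z) :=
    hpi.bdd_mul (c := M) hc.aestronglyMeasurable (Filter.Eventually.of_forall hM')
  have hI3 : Integrable (fun z => φ z * p z) :=
    hpi.bdd_mul (c := M) hφ.aestronglyMeasurable (Filter.Eventually.of_forall hM)
  have := integral_mul_deriv_eq_deriv_mul_of_integrable (fun x _ => hd x) (fun x _ => hpd x)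
    hI1 hI2 hI3
  calc ∫ z, p z • (z * φ z) = - ∫ z, φ z * (- z * p z) := by
        rw [← integral_neg]; congr 1; funext z; simp; ring
    _ = ∫ z, p z • φ' z := by
        rw [this, neg_neg]; congr 1; funext z; simp; ring

open ProbabilityTheory in
/-- The standard Gaussian on the plane. -/
noncomputable def gam : Measure (ℝ × ℝ) := (gaussianReal 0 1).prod (gaussianReal 0 1)

instance : IsProbabilityMeasure gam := by unfold gam; infer_instance

open ProbabilityTheory in
lemma integrable_fst_gam : Integrable (fun z : ℝ × ℝ => z.1) gam := by
  have h : Integrable (fun z : ℝ => z) (gaussianReal 0 1) :=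
    (memLp_id_gaussianReal (μ := 0) (v := 1) 1).integrable le_rfl
  exact h.comp_fst _

open ProbabilityTheory in
lemma integrable_snd_gam : Integrable (fun z : ℝ × ℝ => z.2) gam := by
  have h : Integrable (fun z : ℝ => z) (gaussianReal 0 1) :=
    (memLp_id_gaussianReal (μ := 0) (v := 1) 1).integrable le_rfl
  exact h.comp_snd _

lemma slice1 {g : ℝ × ℝ → ℝ} (hg : ContDiff ℝ (⊤ : ℕ∞) g) (x : ℝ × ℝ) (s b z : ℝ) :
    HasDerivAt (fun t : ℝ => g (x + s • (t, b))) (s * pd1 g (x + s • (z, b))) z := by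
  have h1 : HasDerivAt (fun t : ℝ => x + s • (t, b)) (s • ((1 : ℝ), (0 : ℝ))) z := by
    have := ((hasDerivAt_id z).prodMk (hasDerivAt_const z b)).const_smul s
    exact this.const_add x
  have h2 := (hg.differentiable (by simp) (x + s • (z, b))).hasFDerivAt.comp_hasDerivAt z h1
  refine h2.congr_deriv ?_
  rw [map_smul]; rfl

lemma slice2 {g : ℝ × ℝ → ℝ} (hg : ContDiff ℝ (⊤ : ℕ∞) g) (x : ℝ × ℝ) (s b z : ℝ) :
    HasDerivAt (fun t : ℝ => g (x + s • (b, t))) (s * pd2 g (x + s • (b, z))) z := by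
  have h1 : HasDerivAt (fun t : ℝ => x + s • (b, t)) (s • ((0 : ℝ), (1 : ℝ))) z := by
    have := ((hasDerivAt_const z b).prodMk (hasDerivAt_id z)).const_smul s
    exact this.const_add x
  have h2 := (hg.differentiable (by simp) (x + s • (b, z))).hasFDerivAt.comp_hasDerivAt z h1
  refine h2.congr_deriv ?_
  rw [map_smul]; rfl

lemma gauss_ibp1 {g : ℝ × ℝ → ℝ} (hg : ContDiff ℝ (⊤ : ℕ∞) g) (hp : ZZPeriodic g)
    (x : ℝ × ℝ) (s : ℝ) :
    Integrable (fun z : ℝ × ℝ => z.1 * g (x + s • z)) gam ∧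
    ∫ z, z.1 * g (x + s • z) ∂gam = s * ∫ z, pd1 g (x + s • z) ∂gam := by
  have hg' := (pd1_smooth hg).continuous
  obtain ⟨M, hM⟩ := bounded_of_periodic hg.continuous hp
  obtain ⟨M', hM'⟩ := bounded_of_periodic hg' (pd1_periodic hp)
  have hgc := hg.continuous
  have hI : Integrable (fun z : ℝ × ℝ => z.1 * g (x + s • z)) gam :=
    integrable_fst_gam.mul_bdd (c := M) (by fun_prop) (Filter.Eventually.of_forall fun z => hM _)
  refine ⟨hI, ?_⟩
  have hI' : Integrable (fun z : ℝ × ℝ => s * pd1 g (x + s • z)) gam :=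
    (integrable_of_periodic hg' (pd1_periodic hp) gam (by fun_prop)).const_mul s
  rw [← integral_const_mul]
  unfold gam at hI hI' ⊢
  rw [integral_prod_symm _ hI, integral_prod_symm _ hI']
  congr 1
  funext b
  refine stein (M := max M (|s| * M')) (fun z => slice1 hg x s b z) (by fun_prop)
    (fun z => (hM _).trans (le_max_left _ _)) (fun z => ?_)
  refine le_trans ?_ (le_max_right _ _)
  rw [norm_mul, Real.norm_eq_abs]
  gcongr
  exact hM' _

lemma gauss_ibp2 {g : ℝ × ℝ → ℝ} (hg : ContDiff ℝ (⊤ : ℕ∞) g) (hp : ZZPeriodic g)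
    (x : ℝ × ℝ) (s : ℝ) :
    Integrable (fun z : ℝ × ℝ => z.2 * g (x + s • z)) gam ∧
    ∫ z, z.2 * g (x + s • z) ∂gam = s * ∫ z, pd2 g (x + s • z) ∂gam := by
  have hg' := (pd2_smooth hg).continuous
  obtain ⟨M, hM⟩ := bounded_of_periodic hg.continuous hp
  obtain ⟨M', hM'⟩ := bounded_of_periodic hg' (pd2_periodic hp)
  have hgc := hg.continuous
  have hI : Integrable (fun z : ℝ × ℝ => z.2 * g (x + s • z)) gam :=
    integrable_snd_gam.mul_bdd (c := M) (by fun_prop) (Filter.Eventually.of_forall fun z => hM _)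
  refine ⟨hI, ?_⟩
  have hI' : Integrable (fun z : ℝ × ℝ => s * pd2 g (x + s • z)) gam :=
    (integrable_of_periodic hg' (pd2_periodic hp) gam (by fun_prop)).const_mul s
  rw [← integral_const_mul]
  unfold gam at hI hI' ⊢
  rw [integral_prod _ hI, integral_prod _ hI']
  congr 1
  funext b
  refine stein (M := max M (|s| * M')) (fun z => slice2 hg x s b z) (by fun_prop)
    (fun z => (hM _).trans (le_max_left _ _)) (fun z => ?_)
  refine le_trans ?_ (le_max_right _ _)
  rw [norm_mul, Real.norm_eq_abs]
  gcongr
  exact hM' _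

lemma fderiv_pair (g : ℝ × ℝ → ℝ) (y z : ℝ × ℝ) :
    fderiv ℝ g y z = z.1 * pd1 g y + z.2 * pd2 g y := by
  have : z = z.1 • ((1 : ℝ), (0 : ℝ)) + z.2 • ((0 : ℝ), (1 : ℝ)) := by ext <;> simp
  conv_lhs => rw [this]
  rw [map_add, map_smul, map_smul]; rfl

/-- Heat equation for Gaussian averages, in the variable `r = √t`. -/
lemma heat {g : ℝ × ℝ → ℝ} (hg : ContDiff ℝ (⊤ : ℕ∞) g) (hp : ZZPeriodic g)
    (x : ℝ × ℝ) (c r : ℝ) :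
    HasDerivAt (fun r => ∫ z, g (x + (c * r) • z) ∂gam)
      (c ^ 2 * r * ∫ z, lap g (x + (c * r) • z) ∂gam) r := by
  have hgc := hg.continuous
  have h1c := (pd1_smooth hg).continuous
  have h2c := (pd2_smooth hg).continuous
  obtain ⟨M1, hM1⟩ := bounded_of_periodic h1c (pd1_periodic hp)
  obtain ⟨M2, hM2⟩ := bounded_of_periodic h2c (pd2_periodic hp)
  have key := hasDerivAt_integral_of_dominated_loc_of_deriv_le (μ := gam) (s := Set.univ) (x₀ := r)
    (F := fun r z => g (x + (c * r) • z))
    (F' := fun r z => c * (z.1 * pd1 g (x + (c * r) • z)) + c * (z.2 * pd2 g (x + (c * r) • z)))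
    (bound := fun z => |c| * (|z.1| * M1) + |c| * (|z.2| * M2)) Filter.univ_mem
    (Filter.Eventually.of_forall fun r => (by fun_prop))
    (integrable_of_periodic hgc hp gam (by fun_prop)) (by fun_prop)
    (Filter.Eventually.of_forall fun z r _ => ?_) ?_
    (Filter.Eventually.of_forall fun z r _ => ?_)
  · refine key.2.congr_deriv ?_
    obtain ⟨i1, e1⟩ := gauss_ibp1 (pd1_smooth hg) (pd1_periodic hp) x (c * r)
    obtain ⟨i2, e2⟩ := gauss_ibp2 (pd2_smooth hg) (pd2_periodic hp) x (c * r)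
    rw [integral_add (i1.const_mul c) (i2.const_mul c), integral_const_mul, integral_const_mul,
      e1, e2]
    unfold lap
    rw [integral_add]
    · ring
    · exact integrable_of_periodic (pd1_smooth (pd1_smooth hg)).continuous
        (pd1_periodic (pd1_periodic hp)) gam (by fun_prop)
    · exact integrable_of_periodic (pd2_smooth (pd2_smooth hg)).continuous
        (pd2_periodic (pd2_periodic hp)) gam (by fun_prop)
  · refine (norm_add_le _ _).trans ?_
    simp only [norm_mul, Real.norm_eq_abs]
    have a1 : |pd1 g (x + (c * r) • z)| ≤ M1 := hM1 _
    have a2 : |pd2 g (x + (c * r) • z)| ≤ M2 := hM2 _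
    gcongr
  · exact ((integrable_fst_gam.abs.mul_const M1).const_mul _).add
      ((integrable_snd_gam.abs.mul_const M2).const_mul _)
  · have h1 : HasDerivAt (fun r : ℝ => x + (c * r) • z) (c • z) r := by
      have := (((hasDerivAt_id r).const_mul c).smul_const z).const_add x
      simpa using this
    have h2 := (hg.differentiable (by simp) (x + (c * r) • z)).hasFDerivAt.comp_hasDerivAt r h1
    refine h2.congr_deriv ?_
    rw [map_smul, fderiv_pair, smul_eq_mul]; ring

/-- The radial weight `2 r exp(-a r²)` on `(0,∞)`. -/
noncomputable def tau (a : ℝ) : Measure ℝ :=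
  (volume.restrict (Set.Ioi 0)).withDensity (fun r => ENNReal.ofReal (2 * r * Real.exp (-a * r ^ 2)))

lemma tau_int {a : ℝ} (ha : 0 < a) : Integrable (fun r : ℝ => 2 * r * Real.exp (-a * r ^ 2)) := by
  have := (integrable_mul_exp_neg_mul_sq ha).const_mul 2
  simpa [mul_assoc] using this

lemma tau_finite {a : ℝ} (ha : 0 < a) : IsFiniteMeasure (tau a) :=
  isFiniteMeasure_withDensity_ofReal (tau_int ha).restrict.2

lemma tau_integral (a : ℝ) (φ : ℝ → ℝ) :
    ∫ r, φ r ∂(tau a) = ∫ r in Set.Ioi (0 : ℝ), 2 * r * Real.exp (-a * r ^ 2) * φ r := by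
  unfold tau
  rw [integral_withDensity_eq_integral_toReal_smul (by fun_prop) (by simp)]
  refine setIntegral_congr_fun measurableSet_Ioi fun r hr => ?_
  have : (0 : ℝ) < r := hr
  simp only [smul_eq_mul]
  rw [ENNReal.toReal_ofReal (by positivity)]

/-- The law of `c r z`. -/
noncomputable def mu (a c : ℝ) : Measure (ℝ × ℝ) :=
  ((tau a).prod gam).map (fun w => (c * w.1) • w.2)

lemma mu_resolvent {a b : ℝ} (ha : 0 < a) (hb : 0 < b) {g : ℝ × ℝ → ℝ}
    (hg : ContDiff ℝ (⊤ : ℕ∞) g) (hp : ZZPeriodic g) (x : ℝ × ℝ) :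
    a * ∫ y, g (x + y) ∂(mu a √(2 * b)) - b * ∫ y, lap g (x + y) ∂(mu a √(2 * b)) = g x := by
  have := tau_finite ha
  set c := √(2 * b) with hc
  have hc2 : c ^ 2 = 2 * b := Real.sq_sqrt (by positivity)
  have hlc : Continuous (lap g) :=
    ((pd1_smooth (pd1_smooth hg)).add (pd2_smooth (pd2_smooth hg))).continuous
  have hlp : ZZPeriodic (lap g) := fun x k => by
    simp only [lap, pd1_periodic (pd1_periodic hp) x k, pd2_periodic (pd2_periodic hp) x k]
  have conv : ∀ {h : ℝ × ℝ → ℝ}, Continuous h → ZZPeriodic h →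
      ∫ y, h (x + y) ∂(mu a c) =
        ∫ r in Set.Ioi (0 : ℝ), 2 * r * Real.exp (-a * r ^ 2) * ∫ z, h (x + (c * r) • z) ∂gam := by
    intro h hh hhp
    unfold mu
    rw [integral_map (by fun_prop) (by fun_prop), integral_prod, tau_integral]
    exact integrable_of_periodic hh hhp _ (by fun_prop)
  have vb : ∀ {h : ℝ × ℝ → ℝ}, Continuous h → ZZPeriodic h →
      ∃ M : ℝ, ∀ r : ℝ, ‖∫ z, h (x + (c * r) • z) ∂gam‖ ≤ M := by
    intro h hh hhp
    obtain ⟨M, hM⟩ := bounded_of_periodic hh hhp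
    refine ⟨M, fun r => ?_⟩
    have := norm_integral_le_of_norm_le_const (μ := gam)
      (Filter.Eventually.of_forall fun z => hM (x + (c * r) • z))
    simpa using this
  have vc : ∀ {h : ℝ × ℝ → ℝ}, Continuous h → ZZPeriodic h →
      Continuous (fun r : ℝ => ∫ z, h (x + (c * r) • z) ∂gam) := by
    intro h hh hhp
    obtain ⟨M, hM⟩ := bounded_of_periodic hh hhp
    refine continuous_of_dominated (bound := fun _ => M) (fun r => by fun_prop)
      (fun r => Filter.Eventually.of_forall fun z => hM _) (integrable_const _)
      (Filter.Eventually.of_forall fun z => by fun_prop)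
  have vi : ∀ {h : ℝ × ℝ → ℝ}, Continuous h → ZZPeriodic h →
      IntegrableOn (fun r => 2 * r * Real.exp (-a * r ^ 2) * ∫ z, h (x + (c * r) • z) ∂gam)
        (Set.Ioi (0 : ℝ)) := by
    intro h hh hhp
    obtain ⟨M, hM⟩ := vb hh hhp
    exact ((tau_int ha).mul_bdd (c := M) (vc hh hhp).aestronglyMeasurable
      (Filter.Eventually.of_forall hM)).integrableOn
  have i1 := (vi hg.continuous hp).const_mul a
  have i2 := (vi hlc hlp).const_mul b
  rw [conv hg.continuous hp, conv hlc hlp, ← integral_const_mul, ← integral_const_mul,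
    ← integral_sub i1 i2]
  have hd : ∀ r : ℝ, HasDerivAt
      (fun r => -(Real.exp (-a * r ^ 2) * ∫ z, g (x + (c * r) • z) ∂gam))
      (a * (2 * r * Real.exp (-a * r ^ 2) * ∫ z, g (x + (c * r) • z) ∂gam) -
       b * (2 * r * Real.exp (-a * r ^ 2) * ∫ z, lap g (x + (c * r) • z) ∂gam)) r := by
    intro r
    have h1 : HasDerivAt (fun r : ℝ => -a * r ^ 2) (-a * (2 * r)) r := by
      refine ((hasDerivAt_pow 2 r).const_mul (-a)).congr_deriv ?_
      norm_num
    refine (h1.exp.mul (heat hg hp x c r)).neg.congr_deriv ?_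
    rw [hc2]; ring
  have ht : Filter.Tendsto (fun r => -(Real.exp (-a * r ^ 2) * ∫ z, g (x + (c * r) • z) ∂gam))
      Filter.atTop (nhds 0) := by
    obtain ⟨M, hM⟩ := vb hg.continuous hp
    have h1 : Filter.Tendsto (fun r : ℝ => Real.exp (-a * r ^ 2)) Filter.atTop (nhds 0) := by
      refine Real.tendsto_exp_atBot.comp ?_
      exact (Filter.tendsto_pow_atTop (by norm_num)).const_mul_atTop_of_neg (by linarith)
    have h2 := h1.zero_mul_isBoundedUnder_le
      (g := fun r => ∫ z, g (x + (c * r) • z) ∂gam) ⟨M, Filter.eventually_map.2 (Filter.Eventually.of_forall hM)⟩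
    simpa using h2.neg
  rw [integral_Ioi_of_hasDerivAt_of_tendsto' (fun r _ => hd r) (i1.sub i2) ht]
  simp

lemma exists_solution {a b : ℝ} (ha : 0 < a) (hb : 0 < b) {g : ℝ × ℝ → ℝ}
    (hg : ContDiff ℝ (⊤ : ℕ∞) g) (hp : ZZPeriodic g) :
    ∃ u : ℝ × ℝ → ℝ, ContDiff ℝ (⊤ : ℕ∞) u ∧ ZZPeriodic u ∧ ∀ x, a * u x - b * lap u x = g x := by
  have := tau_finite ha
  have : IsFiniteMeasure (mu a √(2 * b)) := by unfold mu; infer_instance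
  refine ⟨fun x => ∫ y, g (x + y) ∂(mu a √(2 * b)), contDiff_avg _ hg hp, ?_, fun x => ?_⟩
  · intro x k
    have : ∀ y, g (x + ((k.1 : ℝ), (k.2 : ℝ)) + y) = g (x + y) := fun y => by
      rw [add_right_comm, hp]
    simp only [this]
  · rw [lap_avg _ hg hp]
    exact mu_resolvent ha hb hg hp x

/-- **Existence and uniqueness of the displacement field on the flat 2-torus.**
For a smooth `ℤ²`-periodic vector field `f` on `ℝ²` and `a₀, a₁ > 0`, the
functional `F(u) = ∫_{[0,1]²} f·u + a₀|u|² + a₁(div u)² + a₁(curl u)² dx`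
attains its minimum over smooth `ℤ²`-periodic vector fields at a unique
minimizer `ustar`, and `ustar` is the unique smooth `ℤ²`-periodic solution of
the elliptic equation `a₀ u − a₁ Δu = −f/2` (componentwise). -/
theorem displacement_field_exists_unique_on_torus
    (f : ℝ × ℝ → ℝ × ℝ) (hf : ContDiff ℝ (⊤ : ℕ∞) f) (hfper : ZZPeriodic f)
    (a₀ a₁ : ℝ) (ha₀ : 0 < a₀) (ha₁ : 0 < a₁) :
    ∃ ustar : ℝ × ℝ → ℝ × ℝ,
      ContDiff ℝ (⊤ : ℕ∞) ustar ∧ ZZPeriodic ustar ∧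
      (∀ u : ℝ × ℝ → ℝ × ℝ, ContDiff ℝ (⊤ : ℕ∞) u → ZZPeriodic u →
        Ffunc f a₀ a₁ ustar ≤ Ffunc f a₀ a₁ u) ∧
      (∀ w : ℝ × ℝ → ℝ × ℝ, ContDiff ℝ (⊤ : ℕ∞) w → ZZPeriodic w →
        (∀ u : ℝ × ℝ → ℝ × ℝ, ContDiff ℝ (⊤ : ℕ∞) u → ZZPeriodic u →
          Ffunc f a₀ a₁ w ≤ Ffunc f a₀ a₁ u) → w = ustar) ∧
      (∀ x : ℝ × ℝ,
        a₀ * (ustar x).1 - a₁ * lap (fun y => (ustar y).1) x = -(f x).1 / 2 ∧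
        a₀ * (ustar x).2 - a₁ * lap (fun y => (ustar y).2) x = -(f x).2 / 2) ∧
      (∀ w : ℝ × ℝ → ℝ × ℝ, ContDiff ℝ (⊤ : ℕ∞) w → ZZPeriodic w →
        (∀ x : ℝ × ℝ,
          a₀ * (w x).1 - a₁ * lap (fun y => (w y).1) x = -(f x).1 / 2 ∧
          a₀ * (w x).2 - a₁ * lap (fun y => (w y).2) x = -(f x).2 / 2) →
        w = ustar) := by
  have h1 : ContDiff ℝ (⊤ : ℕ∞) (fun x => -(f x).1 / 2) := hf.fst.neg.div_const 2
  have h2 : ContDiff ℝ (⊤ : ℕ∞) (fun x => -(f x).2 / 2) := hf.snd.neg.div_const 2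
  obtain ⟨u1, s1, p1, e1⟩ := exists_solution ha₀ ha₁ h1 (fun x k => by simp only [hfper x k])
  obtain ⟨u2, s2, p2, e2⟩ := exists_solution ha₀ ha₁ h2 (fun x k => by simp only [hfper x k])
  have hs : ContDiff ℝ (⊤ : ℕ∞) (fun x => (u1 x, u2 x)) := s1.prodMk s2
  have hper : ZZPeriodic (fun x => (u1 x, u2 x)) := fun x k => by simp only [p1 x k, p2 x k]
  have hpde : SolvesPDE f a₀ a₁ (fun x => (u1 x, u2 x)) := fun x => ⟨e1 x, e2 x⟩
  -- any solution is a minimizer, with a quadratic excess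
  have excess : ∀ w u : ℝ × ℝ → ℝ × ℝ, ContDiff ℝ (⊤ : ℕ∞) w → ZZPeriodic w →
      SolvesPDE f a₀ a₁ w → ContDiff ℝ (⊤ : ℕ∞) u → ZZPeriodic u →
      Ffunc f a₀ a₁ u = Ffunc f a₀ a₁ w
        + ∫ x in unitSquare, quadPart a₀ a₁ (fun x => u x - w x) x := by
    intro w u hw pw sw hu pu
    have := energy hf hw pw (hu.sub hw) (fun x k => by simp only [pu x k, pw x k]) sw
    simpa using this
  have ge : ∀ w u : ℝ × ℝ → ℝ × ℝ, ContDiff ℝ (⊤ : ℕ∞) w → ZZPeriodic w →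
      SolvesPDE f a₀ a₁ w → ContDiff ℝ (⊤ : ℕ∞) u → ZZPeriodic u →
      Ffunc f a₀ a₁ w ≤ Ffunc f a₀ a₁ u := by
    intro w u hw pw sw hu pu
    rw [excess w u hw pw sw hu pu]
    have : 0 ≤ ∫ x in unitSquare, quadPart a₀ a₁ (fun x => u x - w x) x :=
      integral_nonneg fun x => by unfold quadPart; positivity
    linarith
  have uniq : ∀ w : ℝ × ℝ → ℝ × ℝ, ContDiff ℝ (⊤ : ℕ∞) w → ZZPeriodic w →
      (∀ u : ℝ × ℝ → ℝ × ℝ, ContDiff ℝ (⊤ : ℕ∞) u → ZZPeriodic u →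
        Ffunc f a₀ a₁ w ≤ Ffunc f a₀ a₁ u) → w = fun x => (u1 x, u2 x) := by
    intro w hw pw hmin
    have h3 := hmin _ hs hper
    rw [excess _ w hs hper hpde hw pw] at h3
    have h4 := zero_of_quad ha₀ ha₁ (hw.sub hs) (fun x k => by simp only [pw x k, p1 x k, p2 x k])
      (by linarith)
    funext x
    exact sub_eq_zero.1 (h4 x)
  exact ⟨fun x => (u1 x, u2 x), hs, hper, fun u hu pu => ge _ u hs hper hpde hu pu, uniq, hpde,
    fun w hw pw sw => uniq w hw pw fun u hu pu => ge w u hw pw sw hu pu⟩
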